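/- Let j, k, m be non-negative integers and n a positive integer with n > k and m > j. Then the graph Γ_ℝ(X^{2j+1} Y^{2k+1}, X^{2m+1} Y^{2n}) has girth six. -/

import Mathlib

/-- The algebraically defined bipartite graph `Γ_R(f₂, f₃)`: the first summand consists of
points `(a₁,a₂,a₃)`, the second of lines `[x₁,x₂,x₃]`; a point is adjacent to a line iff
`a₂ + x₂ = f₂ (a₁, x₁)` and `a₃ + x₃ = f₃ (a₁, x₁)`. -/
def adGraph (R : Type*) [CommRing R] (f₂ f₃ : R × R → R) :
    SimpleGraph ((R × R × R) ⊕ (R × R × R)) :=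
  SimpleGraph.fromRel (fun u v =>
    ∃ a x : R × R × R, u = Sum.inl a ∧ v = Sum.inr x ∧
      a.2.1 + x.2.1 = f₂ (a.1, x.1) ∧ a.2.2 + x.2.2 = f₃ (a.1, x.1))

/-- The real monomial graph `Γ_ℝ(X^s Y^t, X^u Y^v)`. -/
noncomputable def monGraph (s t u v : ℕ) : SimpleGraph ((ℝ × ℝ × ℝ) ⊕ (ℝ × ℝ × ℝ)) :=
  adGraph ℝ (fun p => p.1 ^ s * p.2 ^ t) (fun p => p.1 ^ u * p.2 ^ v)

theorem adGraph_adj_inl_inr {R : Type*} [CommRing R] (f₂ f₃ : R × R → R) (a x : R × R × R) :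
    (adGraph R f₂ f₃).Adj (Sum.inl a) (Sum.inr x) ↔
      a.2.1 + x.2.1 = f₂ (a.1, x.1) ∧ a.2.2 + x.2.2 = f₃ (a.1, x.1) := by
  obtain ⟨a₁, a₂, a₃⟩ := a
  obtain ⟨x₁, x₂, x₃⟩ := x
  simp [adGraph, SimpleGraph.fromRel_adj]

theorem adGraph_isLeft_ne {R : Type*} [CommRing R] (f₂ f₃ : R × R → R)
    {v w : (R × R × R) ⊕ (R × R × R)} (h : (adGraph R f₂ f₃).Adj v w) :
    v.isLeft ≠ w.isLeft := by
  rcases v with v | v <;> rcases w with w | w <;> simp_all [adGraph, SimpleGraph.fromRel_adj]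

theorem monGraph_eq_or_eq_of_adj {s t u v : ℕ} (hs : Odd s) (ht : Odd t) {a b x y : ℝ × ℝ × ℝ}
    (hax : (monGraph s t u v).Adj (Sum.inl a) (Sum.inr x))
    (hbx : (monGraph s t u v).Adj (Sum.inl b) (Sum.inr x))
    (hby : (monGraph s t u v).Adj (Sum.inl b) (Sum.inr y))
    (hay : (monGraph s t u v).Adj (Sum.inl a) (Sum.inr y)) : a = b ∨ x = y := by
  simp only [monGraph, adGraph_adj_inl_inr] at hax hbx hby hay
  have h : (a.1 ^ s - b.1 ^ s) * (x.1 ^ t - y.1 ^ t) = 0 := by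
    linear_combination -hax.1 + hbx.1 - hby.1 + hay.1
  rcases mul_eq_zero.1 h with h | h
  · have h1 : a.1 = b.1 := hs.pow_injective (sub_eq_zero.1 h)
    rw [h1] at hax
    exact Or.inl (Prod.ext h1 (Prod.ext (by linarith) (by linarith)))
  · have h1 : x.1 = y.1 := ht.pow_injective (sub_eq_zero.1 h)
    rw [h1] at hax
    exact Or.inr (Prod.ext h1 (Prod.ext (by linarith) (by linarith)))

theorem six_le_egirth_monGraph {s t u v : ℕ} (hs : Odd s) (ht : Odd t) :
    6 ≤ (monGraph s t u v).egirth := by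
  rw [SimpleGraph.le_egirth]
  intro p w hw
  have h3 := hw.three_le_length
  have heven : Even w.length := by
    let c : (monGraph s t u v).Coloring Bool :=
      SimpleGraph.Coloring.mk Sum.isLeft fun h => adGraph_isLeft_ne _ _ h
    exact (c.even_length_iff_congr w).2 Iff.rfl
  by_contra hlt
  have hlt : w.length < 6 := by
    rw [not_le] at hlt
    exact_mod_cast hlt
  have h4 : w.length = 4 := by
    obtain ⟨r, hr⟩ := heven
    omega
  match w, h4 with
  | .cons (v := q) h1 (.cons (v := r) h2 (.cons (v := z) h3 (.cons h4 .nil))), _ =>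
    have hn := hw.support_nodup
    simp only [SimpleGraph.Walk.support_cons, SimpleGraph.Walk.support_nil, List.tail_cons,
      List.nodup_cons, List.mem_cons, not_or] at hn
    have e1 := adGraph_isLeft_ne _ _ h1
    have e2 := adGraph_isLeft_ne _ _ h2
    have e3 := adGraph_isLeft_ne _ _ h3
    have key := fun a b x y => @monGraph_eq_or_eq_of_adj s t u v hs ht a b x y
    rcases p with p | p <;> rcases q with q | q <;> rcases r with r | r <;> rcases z with z | z <;>
      simp at e1 e2 e3
    · rcases key _ _ _ _ h1 h2.symm h3 h4.symm with h | h <;> simp_all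
    · rcases key _ _ _ _ h1.symm h4 h3.symm h2 with h | h <;> simp_all

open Filter Topology in
theorem exists_pow_add_pow_eq {N M : ℝ} (hN : 0 < N) (hNM : N < M) {t v : ℕ} (ht : Odd t)
    (hv : Even v) (hv0 : v ≠ 0) :
    ∃ x y : ℝ, x < 1 ∧ 1 < y ∧ N * (x ^ t - 1) + (y ^ t - 1) = 0 ∧
      M * (x ^ v - 1) + (y ^ v - 1) = 0 := by
  have ht0 : t ≠ 0 := ht.pos.ne'
  have htR : (t : ℝ) ≠ 0 := by exact_mod_cast ht0
  let g : ℝ → ℝ := fun x => 1 + N * (1 - x ^ t)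
  let F : ℝ → ℝ := fun x => M * (x ^ v - 1) + (g x ^ ((v : ℝ) / t) - 1)
  have hg : ∀ x < 1, 1 < g x := fun x hx => by
    have : x ^ t < 1 := by simpa using ht.strictMono_pow hx
    have := mul_pos hN (sub_pos.2 this)
    simp only [g]; linarith
  have hg1 : g 1 = 1 := by simp [g]
  have hF1 : F 1 = 0 := by simp [F, hg1]
  have hgd : HasDerivAt g (-(N * t)) 1 := by
    have h : HasDerivAt g _ 1 :=
      (((hasDerivAt_pow t (1 : ℝ)).const_sub 1).const_mul N).const_add 1
    simpa using h
  have hFd : HasDerivAt F ((M - N) * v) 1 := by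
    have h1 := ((hasDerivAt_pow v (1 : ℝ)).sub_const 1).const_mul M
    have h2 := (hgd.rpow_const (p := (v : ℝ) / t) (Or.inl (by simp [hg1]))).sub_const 1
    have h3 : HasDerivAt F _ 1 := h1.add h2
    convert h3 using 1
    simp only [hg1, one_pow, Real.one_rpow]
    field_simp
    ring
  have hpos : 0 < (M - N) * v :=
    mul_pos (sub_pos.2 hNM) (by exact_mod_cast Nat.pos_of_ne_zero hv0)
  obtain ⟨x₀, hx₀, hx₀', hFx₀⟩ : ∃ x₀, -1 < x₀ ∧ x₀ < 1 ∧ F x₀ < 0 := by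
    have h1 := (hasDerivAt_iff_tendsto_slope_left_right.1 hFd).1.eventually (lt_mem_nhds hpos)
    have h2 : ∀ᶠ x in 𝓝[<] (1 : ℝ), x ∈ Set.Ioo (-1 : ℝ) 1 :=
      Ioo_mem_nhdsLT (by norm_num)
    obtain ⟨x, hx, hx'⟩ := (h1.and h2).exists
    refine ⟨x, hx'.1, hx'.2, ?_⟩
    rw [slope_def_field, hF1] at hx
    have hx1 : 0 < 1 - x := sub_pos.2 hx'.2
    by_contra! hc
    have : (F x - 0) / (x - 1) ≤ 0 := by
      apply div_nonpos_of_nonneg_of_nonpos <;> linarith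
    linarith
  have hF2 : 0 ≤ F (-1) := by
    have h := hg (-1) (by norm_num)
    have := Real.one_le_rpow h.le (z := (v : ℝ) / t) (by positivity)
    simp only [F, hv.neg_one_pow]
    linarith
  have hcont : ContinuousOn F (Set.Icc (-1) x₀) := by
    have hgc : Continuous g := by fun_prop
    have : ContinuousOn (fun x => g x ^ ((v : ℝ) / t)) (Set.Icc (-1) x₀) :=
      hgc.continuousOn.rpow_const fun x hx =>
        Or.inl (zero_lt_one.trans (hg x (hx.2.trans_lt hx₀'))).ne'
    fun_prop
  obtain ⟨x, hx, hFx⟩ := intermediate_value_Icc' hx₀.le hcont ⟨hFx₀.le, hF2⟩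
  have hx1 := hx.2.trans_lt hx₀'
  have hgx := hg x hx1
  have hgx0 : 0 ≤ g x := by linarith
  refine ⟨x, g x ^ ((1 : ℝ) / t), hx1, Real.one_lt_rpow hgx ?_, ?_, ?_⟩
  · have := ht.pos
    positivity
  · rw [← Real.rpow_natCast (g x ^ _), ← Real.rpow_mul hgx0, one_div_mul_cancel htR, Real.rpow_one]
    simp only [g]; ring
  · rw [← Real.rpow_natCast (g x ^ _), ← Real.rpow_mul hgx0, one_div_mul_eq_div]
    exact hFx

theorem egirth_monGraph_le_six {s t u v : ℕ} (hs : s ≠ 0) (hsu : s < u) (ht : Odd t)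
    (hv : Even v) (hv0 : v ≠ 0) : (monGraph s t u v).egirth ≤ 6 := by
  have hN : (0 : ℝ) < 2 ^ s - 1 := sub_pos.2 (one_lt_pow₀ one_lt_two hs)
  have hNM : (2 : ℝ) ^ s - 1 < 2 ^ u - 1 := by
    have : (2 : ℝ) ^ s < 2 ^ u := pow_lt_pow_right₀ one_lt_two hsu
    linarith
  obtain ⟨x, y, hx, hy, h₂, h₃⟩ := exists_pow_add_pow_eq hN hNM ht hv hv0
  have hu : u ≠ 0 := by omega
  let a : ℝ × ℝ × ℝ := (2, 0, 0)
  let b : ℝ × ℝ × ℝ := (1, x ^ t - 2 ^ s * x ^ t, x ^ v - 2 ^ u * x ^ v)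
  let c : ℝ × ℝ × ℝ := (0, -2 ^ s, -2 ^ u)
  let X : ℝ × ℝ × ℝ := (x, 2 ^ s * x ^ t, 2 ^ u * x ^ v)
  let Y : ℝ × ℝ × ℝ := (y, 2 ^ s, 2 ^ u)
  let Z : ℝ × ℝ × ℝ := (1, 2 ^ s, 2 ^ u)
  let G := monGraph s t u v
  have haX : G.Adj (Sum.inl a) (Sum.inr X) := (adGraph_adj_inl_inr _ _ _ _).2 (by simp [a, X])
  have hbX : G.Adj (Sum.inl b) (Sum.inr X) := (adGraph_adj_inl_inr _ _ _ _).2 (by simp [b, X])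
  have hbY : G.Adj (Sum.inl b) (Sum.inr Y) := (adGraph_adj_inl_inr _ _ _ _).2 (by
    simp only [b, Y, one_pow, one_mul]
    exact ⟨by linarith, by linarith⟩)
  have hcY : G.Adj (Sum.inl c) (Sum.inr Y) :=
    (adGraph_adj_inl_inr _ _ _ _).2 (by simp [c, Y, hs, hu])
  have hcZ : G.Adj (Sum.inl c) (Sum.inr Z) :=
    (adGraph_adj_inl_inr _ _ _ _).2 (by simp [c, Z, hs, hu])
  have haZ : G.Adj (Sum.inl a) (Sum.inr Z) := (adGraph_adj_inl_inr _ _ _ _).2 (by simp [a, Z])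
  have hab : a ≠ b := fun h => by simpa [a, b] using congrArg Prod.fst h
  have hac : a ≠ c := fun h => by simpa [a, c] using congrArg Prod.fst h
  have hbc : b ≠ c := fun h => by simpa [b, c] using congrArg Prod.fst h
  have hXY : X ≠ Y := fun h => (hx.trans hy).ne (congrArg Prod.fst h)
  have hXZ : X ≠ Z := fun h => hx.ne (congrArg Prod.fst h)
  have hYZ : Y ≠ Z := fun h => hy.ne' (congrArg Prod.fst h)
  let w : G.Walk (Sum.inl a) (Sum.inl a) :=
    .cons haX (.cons hbX.symm (.cons hbY (.cons hcY.symm (.cons hcZ (.cons haZ.symm .nil)))))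
  have hw : w.IsCycle := by
    simp only [w, SimpleGraph.Walk.cons_isCycle_iff, SimpleGraph.Walk.cons_isPath_iff]
    clear_value a b c X Y Z
    simp [*, hab.symm, hac.symm]
  exact SimpleGraph.egirth_le_length hw

theorem girth_six_of_k_lt_n_j_lt_m (j k m n : ℕ) (hn : 0 < n) (hnk : k < n) (hjm : j < m) :
    (monGraph (2 * j + 1) (2 * k + 1) (2 * m + 1) (2 * n)).egirth = 6 :=
  le_antisymm
    (egirth_monGraph_le_six (by omega) (by omega) (odd_two_mul_add_one k) (even_two_mul n)
      (by omega))
    (six_le_egirth_monGraph (odd_two_mul_add_one j) (odd_two_mul_add_one k))
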